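/- arXiv:2202.10043 — 7 statements merged into one kernel-verified Lean document; each statement's English description precedes it below -/
import Mathlib

section
/- Let d ≥ 1 and n_p ≥ 1. Suppose α_1, …, α_{n_p} are nonnegative real numbers with ∑_{j=1}^{n_p} α_j = 1, and U_1, …, U_{n_p} ∈ ℝ^d. Define the average Ū = ∑_{j=1}^{n_p} α_j U_j. Let θ_1, …, θ_{n_p} ∈ [0,1] and set Ũ_j = Ū + θ_j (U_j − Ū); assume the modification preserves the average, i.e. ∑_{j=1}^{n_p} α_j Ũ_j = Ū. Then for every convex function η : ℝ^d → ℝ one has ∑_{j=1}^{n_p} α_j η(Ũ_j) ≤ ∑_{j=1}^{n_p} α_j η(U_j); that is, the linear scaling (bound-preserving) limiter does not increase the entropy. -/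
/-- The linear scaling (bound-preserving) limiter does not increase the entropy:
if the nodal values `U j` are squeezed toward the cell average `Ū = ∑ α j • U j`
via `Ũ j = Ū + θ j • (U j - Ū)` with `θ j ∈ [0,1]`, preserving the average,
then for every convex entropy `η` we have `∑ α j * η (Ũ j) ≤ ∑ α j * η (U j)`. -/
theorem limiter_does_not_increase_entropy
    (d np : ℕ) (hd : 1 ≤ d) (hnp : 1 ≤ np)
    (α : Fin np → ℝ) (hα : ∀ j, 0 ≤ α j) (hαsum : ∑ j, α j = 1)
    (U : Fin np → EuclideanSpace ℝ (Fin d))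
    (Ubar : EuclideanSpace ℝ (Fin d)) (hUbar : Ubar = ∑ j, α j • U j)
    (θ : Fin np → ℝ) (hθ0 : ∀ j, 0 ≤ θ j) (hθ1 : ∀ j, θ j ≤ 1)
    (Ut : Fin np → EuclideanSpace ℝ (Fin d))
    (hUt : ∀ j, Ut j = Ubar + θ j • (U j - Ubar))
    (havg : ∑ j, α j • Ut j = Ubar)
    (η : EuclideanSpace ℝ (Fin d) → ℝ)
    (hη : ConvexOn ℝ Set.univ η) :
    ∑ j, α j * η (Ut j) ≤ ∑ j, α j * η (U j) := by
  have hterm (j) : α j * η (Ut j) ≤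
      α j * η (U j) - α j * (1 - θ j) * η (U j) + α j * (1 - θ j) * η Ubar := by
    have hconv := hη.2 (Set.mem_univ Ubar) (Set.mem_univ (U j))
      (sub_nonneg.2 (hθ1 j)) (hθ0 j) (sub_add_cancel 1 (θ j))
    have hcomb : (1 - θ j) • Ubar + θ j • U j = Ut j := by rw [hUt]; module
    rw [hcomb, smul_eq_mul, smul_eq_mul] at hconv
    linarith [mul_le_mul_of_nonneg_left hconv (hα j)]
  have hbary : (1 - ∑ j, α j * (1 - θ j)) • Ubar + ∑ j, (α j * (1 - θ j)) • U j = Ubar := by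
    have hterms (j) : (α j * (1 - θ j)) • U j =
        α j • U j - α j • Ut j + (α j * (1 - θ j)) • Ubar := by rw [hUt]; module
    simp_rw [hterms]
    rw [Finset.sum_add_distrib, Finset.sum_sub_distrib, havg, ← hUbar, ← Finset.sum_smul]
    module
  have hle : ∑ j, α j * (1 - θ j) ≤ 1 := by
    exact (Finset.sum_le_sum fun j _ =>
      mul_le_of_le_one_right (hα j) (sub_le_self 1 (hθ0 j))).trans_eq hαsum
  have hjensen := hη.map_add_sum_le (t := Finset.univ) (w := fun j => α j * (1 - θ j)) (p := U)
    (v := 1 - ∑ j, α j * (1 - θ j)) (q := Ubar)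
    (fun j _ => mul_nonneg (hα j) (sub_nonneg.2 (hθ1 j))) (sub_add_cancel _ _)
    (fun _ _ => Set.mem_univ _) (sub_nonneg.2 hle) (Set.mem_univ _)
  rw [hbary] at hjensen
  simp only [smul_eq_mul] at hjensen
  have hsum := Finset.sum_le_sum fun j (_ : j ∈ Finset.univ) => hterm j
  rw [Finset.sum_add_distrib, Finset.sum_sub_distrib, ← Finset.sum_mul] at hsum
  linarith
end

section
/- (Summation-by-parts property for Gauss–Lobatto-type quadrature.) Let p ≥ 1 and let −1 = ξ_0 < ξ_1 < ⋯ < ξ_p = 1 be distinct nodes in [−1,1] with weights ω_0, …, ω_p such that the quadrature rule is exact for polynomials of degree at most 2p−1, i.e. ∑_{r=0}^{p} ω_r q(ξ_r) = ∫_{−1}^{1} q(x) dx for every real polynomial q with deg q ≤ 2p−1. Let L_0, …, L_p be the Lagrange basis polynomials at these nodes (L_j(ξ_l) = δ_{jl}), and define the (p+1)×(p+1) matrices D with D_{jl} = L_l′(ξ_j), M = diag(ω_0, …, ω_p), and Q = M D. Then Q + Qᵀ = B, where B = diag(−1, 0, …, 0, 1), i.e. for all 0 ≤ j, l ≤ p: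 ω_j L_l′(ξ_j) + ω_l L_j′(ξ_l) = δ_{jp} δ_{lp} − δ_{j0} δ_{l0}. -/
open Polynomial

theorem Polynomial.integral_eval_derivative (q : ℝ[X]) (a b : ℝ) :
    ∫ x in a..b, (derivative q).eval x = q.eval b - q.eval a :=
  intervalIntegral.integral_eq_sub_of_hasDerivAt (fun x _ => q.hasDerivAt x)
    ((derivative q).continuous.intervalIntegrable a b)

/-- Summation-by-parts property for Gauss–Lobatto-type quadrature: with nodes
`-1 = ξ₀ < ⋯ < ξ_p = 1`, weights `ω` exact for polynomials of degree `≤ 2p-1`,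
and Lagrange basis polynomials `L j`, the matrices `Q = M D` (with
`D_{jl} = L_l'(ξ_j)`, `M = diag ω`) satisfy `Q + Qᵀ = B = diag (-1,0,…,0,1)`. -/
theorem summation_by_parts_property
    (p : ℕ) (hp : 1 ≤ p)
    (ξ : Fin (p + 1) → ℝ) (hmono : StrictMono ξ)
    (hξ0 : ξ 0 = -1) (hξp : ξ (Fin.last p) = 1)
    (ω : Fin (p + 1) → ℝ)
    (hquad : ∀ q : Polynomial ℝ, q.natDegree ≤ 2 * p - 1 →
      ∑ r, ω r * q.eval (ξ r) = ∫ x in (-1 : ℝ)..1, q.eval x)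
    (L : Fin (p + 1) → Polynomial ℝ)
    (hLdeg : ∀ j, (L j).natDegree ≤ p)
    (hL : ∀ j l, (L j).eval (ξ l) = if j = l then 1 else 0) :
    ∀ j l : Fin (p + 1),
      ω j * (Polynomial.derivative (L l)).eval (ξ j)
        + ω l * (Polynomial.derivative (L j)).eval (ξ l)
      = (if j = Fin.last p then (1 : ℝ) else 0) * (if l = Fin.last p then 1 else 0)
        - (if j = 0 then 1 else 0) * (if l = 0 then 1 else 0) := by
  intro j l
  have hdeg : (derivative (L j * L l)).natDegree ≤ 2 * p - 1 := by
    have hmul : (L j * L l).natDegree ≤ p + p := natDegree_mul_le_of_le (hLdeg j) (hLdeg l)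
    have hder := natDegree_derivative_le (L j * L l)
    omega
  have h := hquad _ hdeg
  rw [Polynomial.integral_eval_derivative, ← hξ0, ← hξp] at h
  simp only [derivative_mul, eval_add, eval_mul, hL, mul_add, Finset.sum_add_distrib, mul_ite,
    ite_mul, mul_one, mul_zero, one_mul, zero_mul, Finset.sum_ite_eq, Finset.mem_univ,
    if_true] at h
  simp only [mul_ite, mul_one, mul_zero]
  linarith
end

section
/- (Local conservation identity of flux differencing.) Let n ≥ 1, let Q be a real n×n matrix such that Q + Qᵀ = B where B = diag(τ_1, …, τ_n) is diagonal, and let d ≥ 1. Let F : {1,…,n} × {1,…,n} → ℝ^d be a symmetric two-point array, i.e. F_{jl} = F_{lj} for all j, l. Then the double sum of the flux-differencing volume terms telescopes to the boundary: ∑_{j=1}^{n} 2 ∑_{l=1}^{n} Q_{jl} F_{jl} = ∑_{j=1}^{n} τ_j F_{jj}. In particular, for a flux-differencing discretization with symmetric consistent volume fluxes and SBP operators, the time derivative of the discrete cell total ∑_j ω_j U_j depends only on the boundary flux values. -/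
/-- Local conservation identity of flux differencing: if `Q + Qᵀ = diag τ` and
the two-point array `F` is symmetric, the double sum of the flux-differencing
volume terms telescopes to the boundary. -/
theorem flux_differencing_conservation
    (n d : ℕ) (hn : 1 ≤ n) (hd : 1 ≤ d)
    (Q : Matrix (Fin n) (Fin n) ℝ) (τ : Fin n → ℝ)
    (hQ : Q + Q.transpose = Matrix.diagonal τ)
    (F : Fin n → Fin n → EuclideanSpace ℝ (Fin d))
    (hF : ∀ j l, F j l = F l j) :
    ∑ j, (2 : ℝ) • (∑ l, Q j l • F j l) = ∑ j, τ j • F j j := by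
  have hswap : ∑ j, ∑ l, Q j l • F j l = ∑ j, ∑ l, Q l j • F j l := by
    rw [Finset.sum_comm]
    exact Finset.sum_congr rfl fun j _ => Finset.sum_congr rfl fun l _ => by rw [hF]
  have hadd : ∀ j l, Q j l + Q l j = Matrix.diagonal τ j l := fun j l => by
    rw [← hQ, Matrix.add_apply, Matrix.transpose_apply]
  calc ∑ j, (2 : ℝ) • (∑ l, Q j l • F j l)
      = ∑ j, ∑ l, Q j l • F j l + ∑ j, ∑ l, Q l j • F j l := by
        rw [← Finset.smul_sum, two_smul, ← hswap]
    _ = ∑ j, ∑ l, Matrix.diagonal τ j l • F j l := by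
        simp only [← Finset.sum_add_distrib, ← add_smul, hadd]
    _ = ∑ j, τ j • F j j := by
        simp [Matrix.diagonal_apply, ite_smul]
end

section
/- (Local entropy conservation identity of flux differencing / Tadmor's condition.) Let n ≥ 1 and d ≥ 1. Let Q be a real n×n matrix with Q + Qᵀ = B where B = diag(τ_1, …, τ_n) is diagonal, and assume all row sums of Q vanish: ∑_{l=1}^{n} Q_{jl} = 0 for every j. Let w_1, …, w_n ∈ ℝ^d (entropy variables), ψ_1, …, ψ_n ∈ ℝ (entropy potentials), and let F : {1,…,n} × {1,…,n} → ℝ^d be a symmetric two-point flux (F_{jl} = F_{lj}) satisfying Tadmor's entropy-conservation condition (w_j − w_l) · F_{jl} = ψ_j − ψ_l for all j, l. Then ∑_{j=1}^{n} w_j · ( 2 ∑_{l=1}^{n} Q_{jl} F_{jl} ) = ∑_{j=1}^{n} τ_j ( w_j · F_{jj} − ψ_j ). Hence contracting the flux-differencing volume terms with the entropy variables leaves only boundary contributions: the scheme is entropy conservative within single elements. -/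
open scoped RealInnerProductSpace

/-- Scalar form of the summation-by-parts identity, where `a j l` stands for `w_j ⬝ F_{jl}`. -/
theorem two_mul_sum_sum_mul_eq_sum_of_add_transpose_eq_diagonal
    {ι R : Type*} [Fintype ι] [DecidableEq ι] [CommRing R]
    {Q : Matrix ι ι R} {τ ψ : ι → R} {a : ι → ι → R}
    (hQ : Q + Q.transpose = Matrix.diagonal τ) (hrow : ∀ j, ∑ l, Q j l = 0)
    (ha : ∀ j l, a j l - a l j = ψ j - ψ l) :
    2 * ∑ j, ∑ l, Q j l * a j l = ∑ j, τ j * (a j j - ψ j) := by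
  have hrowψ : ∑ j, ∑ l, Q j l * ψ j = 0 := by
    simp [← Finset.sum_mul, hrow]
  have hcolψ : ∑ j, ∑ l, Q l j * ψ l = 0 := by
    rw [Finset.sum_comm, hrowψ]
  have hentry (j l : ι) : Q j l + Q l j = Matrix.diagonal τ j l := congrFun₂ hQ j l
  have hpair (j l : ι) : Q j l * a j l + Q l j * a l j =
      Matrix.diagonal τ j l * (a l j - ψ l) + Q j l * ψ j + Q l j * ψ l := by
    rw [← hentry]
    linear_combination Q j l * ha j l
  calc 2 * ∑ j, ∑ l, Q j l * a j l
      = ∑ j, ∑ l, (Q j l * a j l + Q l j * a l j) := by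
        simp only [Finset.sum_add_distrib]
        rw [Finset.sum_comm (f := fun j l => Q l j * a l j), two_mul]
    _ = ∑ j, ∑ l, Matrix.diagonal τ j l * (a l j - ψ l) := by
        simp only [hpair, Finset.sum_add_distrib, hrowψ, hcolψ, add_zero]
    _ = ∑ j, τ j * (a j j - ψ j) := by
        simp [Matrix.diagonal_apply]

/-- Local entropy conservation identity of flux differencing: if `Q + Qᵀ = diag τ`
with vanishing row sums, and the symmetric two-point flux `F` satisfies
Tadmor's condition `(w_j - w_l) ⬝ F_{jl} = ψ_j - ψ_l`, then contracting the
flux-differencing volume terms with the entropy variables leaves only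
boundary contributions. -/
theorem flux_differencing_entropy_conservation
    (n d : ℕ) (hn : 1 ≤ n) (hd : 1 ≤ d)
    (Q : Matrix (Fin n) (Fin n) ℝ) (τ : Fin n → ℝ)
    (hQ : Q + Q.transpose = Matrix.diagonal τ)
    (hrow : ∀ j, ∑ l, Q j l = 0)
    (w : Fin n → EuclideanSpace ℝ (Fin d)) (ψ : Fin n → ℝ)
    (F : Fin n → Fin n → EuclideanSpace ℝ (Fin d))
    (hF : ∀ j l, F j l = F l j)
    (hTadmor : ∀ j l, ⟪w j - w l, F j l⟫ = ψ j - ψ l) :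
    ∑ j, ⟪w j, (2 : ℝ) • (∑ l, Q j l • F j l)⟫
      = ∑ j, τ j * (⟪w j, F j j⟫ - ψ j) := by
  have ha (j l : Fin n) : ⟪w j, F j l⟫ - ⟪w l, F l j⟫ = ψ j - ψ l := by
    rw [hF l j, ← inner_sub_left, hTadmor]
  rw [← two_mul_sum_sum_mul_eq_sum_of_add_transpose_eq_diagonal hQ hrow ha]
  simp only [inner_smul_right, inner_sum, Finset.mul_sum]
end

section
/- (Entropy conservation of Ranocha's two-point flux for the 2D complete Euler equations, x-direction.) Let γ > 1 and let two states (ρ⁻, u₁⁻, u₂⁻, p⁻) and (ρ⁺, u₁⁺, u₂⁺, p⁺) satisfy ρ^± > 0, p^± > 0, ρ⁺ ≠ ρ⁻, and ρ⁺/p⁺ ≠ ρ⁻/p⁻. Denote arithmetic means ā = (a⁻ + a⁺)/2, jumps [a] = a⁺ − a⁻, and logarithmic means a^{log} = (a⁺ − a⁻)/(log a⁺ − log a⁻). Define the x-direction numerical flux f^num ∈ ℝ⁴ by: f^num_ρ = ρ^{log}·ū₁; f^num_{ρu₁} = ū₁·f^num_ρ + p̄; f^num_{ρu₂} = ū₂·f^num_ρ;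 f^num_E = f^num_ρ·( ½(u₁⁻u₁⁺ + u₂⁻u₂⁺) + 1/((γ−1)·(ρ/p)^{log}) ) + ½(p⁻u₁⁺ + p⁺u₁⁻), where (ρ/p)^{log} is the logarithmic mean of ρ⁻/p⁻ and ρ⁺/p⁺. Let w^± ∈ ℝ⁴ be the entropy variables w = ( γ/(γ−1) − s/(γ−1) − ρ(u₁²+u₂²)/(2p), ρu₁/p, ρu₂/p, −ρ/p ) with s = log(p/ρ^γ), evaluated at the two states, and let ψ₁^± = ρ^± u₁^± be the entropy potential in the x-direction. Then the flux satisfies Tadmor's entropy-conservation condition: (w⁺ − w⁻) · f^num = ψ₁⁺ − ψ₁⁻ = ρ⁺u₁⁺ − ρ⁻u₁⁻. -/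
/-- The logarithmic mean of two positive numbers. -/
noncomputable def logMean (a b : ℝ) : ℝ := (b - a) / (Real.log b - Real.log a)

theorem logMean_mul_log_sub {a b : ℝ} (ha : 0 < a) (hb : 0 < b) (hab : b ≠ a) :
    logMean a b * (Real.log b - Real.log a) = b - a :=
  div_mul_cancel₀ _ (sub_ne_zero.mpr fun h => hab (Real.log_injOn_pos hb ha h))

theorem sub_div_logMean {a b : ℝ} (hab : b ≠ a) :
    (b - a) / logMean a b = Real.log b - Real.log a :=
  div_div_cancel₀ (sub_ne_zero.mpr hab)

/-- The thermodynamic entropy in terms of the density and the inverse temperature `ρ / p`. -/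
theorem log_div_rpow_eq {ρ p : ℝ} (γ : ℝ) (hρ : 0 < ρ) (hp : 0 < p) :
    Real.log (p / ρ ^ γ) = -Real.log (ρ / p) - (γ - 1) * Real.log ρ := by
  rw [Real.log_div hp.ne' (Real.rpow_pos_of_pos hρ γ).ne', Real.log_rpow hρ,
    Real.log_div hρ.ne' hp.ne']
  ring

/-- Entropy conservation (Tadmor's condition) of Ranocha's two-point numerical
flux for the 2D complete Euler equations in the x-direction:
`(w⁺ - w⁻) ⬝ f^num = ψ₁⁺ - ψ₁⁻ = ρ⁺u₁⁺ - ρ⁻u₁⁻`, where `w` are the entropy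
variables of the entropy `η = -ρ s/(γ-1)`, `s = log (p/ρ^γ)`. -/
theorem ranocha_flux_entropy_conservative
    (γ ρm ρp u1m u1p u2m u2p pm pp : ℝ)
    (hγ : 1 < γ) (hρm : 0 < ρm) (hρp : 0 < ρp) (hpm : 0 < pm) (hpp : 0 < pp)
    (hρne : ρp ≠ ρm) (hρpne : ρp / pp ≠ ρm / pm) :
    -- Ranocha's flux components (x-direction)
    let fρ : ℝ := logMean ρm ρp * ((u1m + u1p) / 2)
    let fρu1 : ℝ := ((u1m + u1p) / 2) * fρ + (pm + pp) / 2
    let fρu2 : ℝ := ((u2m + u2p) / 2) * fρ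
    let fE : ℝ := fρ * ((u1m * u1p + u2m * u2p) / 2
        + 1 / ((γ - 1) * logMean (ρm / pm) (ρp / pp)))
        + (pm * u1p + pp * u1m) / 2
    -- entropy variables at the two states
    let w1m : ℝ := γ / (γ - 1) - Real.log (pm / ρm ^ γ) / (γ - 1)
        - ρm * (u1m ^ 2 + u2m ^ 2) / (2 * pm)
    let w1p : ℝ := γ / (γ - 1) - Real.log (pp / ρp ^ γ) / (γ - 1)
        - ρp * (u1p ^ 2 + u2p ^ 2) / (2 * pp)
    (w1p - w1m) * fρ
      + (ρp * u1p / pp - ρm * u1m / pm) * fρu1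
      + (ρp * u2p / pp - ρm * u2m / pm) * fρu2
      + (-(ρp / pp) - -(ρm / pm)) * fE
      = ρp * u1p - ρm * u1m := by
  intro fρ fρu1 fρu2 fE w1m w1p
  have hγ' : γ - 1 ≠ 0 := sub_ne_zero.mpr hγ.ne'
  have hρ := logMean_mul_log_sub hρm hρp hρne
  have hβ := sub_div_logMean hρpne
  simp only [fE, fρu1, fρu2, fρ, w1m, w1p, log_div_rpow_eq γ hρm hpm, log_div_rpow_eq γ hρp hpp]
  clear fE fρu1 fρu2 fρ w1m w1p
  generalize logMean ρm ρp = L at *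
  generalize logMean (ρm / pm) (ρp / pp) = M at *
  generalize Real.log (ρp / pp) = lβp at *
  generalize Real.log (ρm / pm) = lβm at *
  generalize Real.log ρp = lp at *
  generalize Real.log ρm = lm at *
  have hM : 1 / ((γ - 1) * M) = M⁻¹ / (γ - 1) := by
    rw [one_div, mul_inv_rev, div_eq_mul_inv]
  rw [hM]
  rw [div_eq_mul_inv _ M] at hβ
  clear hM
  generalize M⁻¹ = K at *
  obtain ⟨βp, rfl⟩ : ∃ β, ρp = β * pp := ⟨ρp / pp, by field_simp⟩
  obtain ⟨βm, rfl⟩ : ∃ β, ρm = β * pm := ⟨ρm / pm, by field_simp⟩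
  rw [mul_div_cancel_right₀ _ hpp.ne', mul_div_cancel_right₀ _ hpm.ne'] at hβ
  field_simp
  linear_combination 2 * (u1m + u1p) * ((γ - 1) * hρ - L * hβ)
end

section
/- Let γ > 1, ρ > 0, p > 0, and m = (m₁, m₂) ∈ ℝ² with |m|² = m₁² + m₂². Then the determinant of the symmetric 4×4 matrix H (defined in the context) equals det H = p⁴ / (ρ⁴ (γ−1)³); in particular det H > 0. -/
/-- The matrix `H` such that the Hessian of the Euler entropy
`η = -ρs/(γ-1)` with respect to the conservative variables `(ρ, m₁, m₂, E)`
equals `(ρ(γ-1)/p²) • H`. -/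
noncomputable def eulerH (γ ρ m1 m2 p : ℝ) : Matrix (Fin 4) (Fin 4) ℝ :=
  !![(1 / 4) * ((m1 ^ 2 + m2 ^ 2) / ρ ^ 2) ^ 2 + γ * p ^ 2 / ((γ - 1) ^ 2 * ρ ^ 2),
        -(m1 * (m1 ^ 2 + m2 ^ 2)) / (2 * ρ ^ 3),
        -(m2 * (m1 ^ 2 + m2 ^ 2)) / (2 * ρ ^ 3),
        (m1 ^ 2 + m2 ^ 2) / (2 * ρ ^ 2) - p / (ρ * (γ - 1));
      -(m1 * (m1 ^ 2 + m2 ^ 2)) / (2 * ρ ^ 3),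
        m1 ^ 2 / ρ ^ 2 + p / (ρ * (γ - 1)),
        m1 * m2 / ρ ^ 2,
        -(m1 / ρ);
      -(m2 * (m1 ^ 2 + m2 ^ 2)) / (2 * ρ ^ 3),
        m1 * m2 / ρ ^ 2,
        m2 ^ 2 / ρ ^ 2 + p / (ρ * (γ - 1)),
        -(m2 / ρ);
      (m1 ^ 2 + m2 ^ 2) / (2 * ρ ^ 2) - p / (ρ * (γ - 1)),
        -(m1 / ρ),
        -(m2 / ρ),
        1]

/-- The determinant of the matrix `H` (the Hessian of the Euler entropy up to
the factor `ρ(γ-1)/p²`) equals `p⁴/(ρ⁴(γ-1)³)`; in particular it is positive. -/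
theorem eulerH_det (γ ρ m1 m2 p : ℝ) (hγ : 1 < γ) (hρ : 0 < ρ) (hp : 0 < p) :
    (eulerH γ ρ m1 m2 p).det = p ^ 4 / (ρ ^ 4 * (γ - 1) ^ 3) ∧
    0 < (eulerH γ ρ m1 m2 p).det := by
  have hγ' : 0 < γ - 1 := sub_pos.mpr hγ
  have hdet : (eulerH γ ρ m1 m2 p).det = p ^ 4 / (ρ ^ 4 * (γ - 1) ^ 3) := by
    have hγ0 := hγ'.ne'
    have hρ0 := hρ.ne'
    simp [eulerH, Matrix.det_succ_row_zero, Fin.sum_univ_succ, Fin.succAbove]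
    field_simp
    ring
  exact ⟨hdet, hdet ▸ by positivity⟩
end

section
/- (Explicit lower bound on the smallest eigenvalue of the Euler entropy Hessian.) Let γ ∈ (1, 2], ρ > 0, p > 0, m = (m₁, m₂) ∈ ℝ², and set |u|² = (m₁² + m₂²)/ρ². Then every eigenvalue μ of the symmetric matrix A = (ρ(γ−1)/p²)·H, with H as defined in the context, satisfies μ ≥ (γ−1)²/p · min{ p/(ρ(γ−1)(|u|²+2)²), ρ(γ−1)/(4(pγ + ρ(γ−1))), 1/(4γ(|u|²+1)) }; equivalently, A − c·I₄ is positive semidefinite for c equal to this explicit quantity. -/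
/-- A lower bound on a real matrix in the Loewner order bounds its eigenvalues from below. -/
theorem le_of_hasEigenvalue_of_posSemidef_sub_smul_one {n : Type*} [Fintype n] [DecidableEq n]
    {A : Matrix n n ℝ} {c μ : ℝ} (hA : (A - c • (1 : Matrix n n ℝ)).PosSemidef)
    (hμ : Module.End.HasEigenvalue (Matrix.toLin' A) μ) : c ≤ μ := by
  obtain ⟨x, hx⟩ := hμ.exists_hasEigenvector
  have hAx : A.mulVec x = μ • x := by simpa using hx.apply_eq_smul
  have hpos : 0 < x ⬝ᵥ x := by
    simpa using Matrix.dotProduct_star_self_pos_iff.mpr hx.2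
  have h := hA.dotProduct_mulVec_nonneg x
  rw [Matrix.sub_mulVec, Matrix.smul_mulVec, Matrix.one_mulVec, hAx, dotProduct_sub,
    dotProduct_smul, dotProduct_smul, smul_eq_mul, smul_eq_mul, star_trivial, ← sub_mul] at h
  exact sub_nonneg.mp (nonneg_of_mul_nonneg_left h hpos)

theorem eulerH_isHermitian (γ ρ m1 m2 p : ℝ) : (eulerH γ ρ m1 m2 p).IsHermitian := by
  ext i j
  fin_cases i <;> fin_cases j <;> simp [eulerH]

/-- The quadratic form of `eulerH` as a sum of squares, in terms of the velocity `(u, v)` and the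
specific internal energy `e`. -/
theorem dotProduct_eulerH_mulVec {γ ρ e : ℝ} (u v : ℝ) (hγ : γ - 1 ≠ 0) (hρ : ρ ≠ 0)
    (x : Fin 4 → ℝ) :
    x ⬝ᵥ (eulerH γ ρ (ρ * u) (ρ * v) (e * (ρ * (γ - 1)))).mulVec x =
      (x 3 + (u ^ 2 + v ^ 2) / 2 * x 0 - u * x 1 - v * x 2 - e * x 0) ^ 2
        + (γ - 1) * e ^ 2 * x 0 ^ 2
        + e * ((x 1 - u * x 0) ^ 2 + (x 2 - v * x 0) ^ 2) := by
  simp only [eulerH, Matrix.mulVec, dotProduct, Fin.sum_univ_four, Matrix.of_apply,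
    Matrix.cons_val]
  field_simp
  ring

/-- Norm bound for the inverse of the change of variables that diagonalises the quadratic form
of `eulerH`. -/
theorem sq_norm_le_mul_diagonal_form {g e : ℝ} (hg : 0 < g) (he : 0 < e) (u v a X Y Z : ℝ) :
    g * e ^ 2 * (a ^ 2 + (Y + u * a) ^ 2 + (Z + v * a) ^ 2
        + (X + (e + (u ^ 2 + v ^ 2) / 2) * a + u * Y + v * Z) ^ 2) ≤
      ((u ^ 2 + v ^ 2 + 2) ^ 2 / 4 + (1 + g) * e ^ 2 + e * (u ^ 2 + v ^ 2)
          + g * e * (1 + (u ^ 2 + v ^ 2))) *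
        (X ^ 2 + g * e ^ 2 * a ^ 2 + e * (Y ^ 2 + Z ^ 2)) := by
  have h1 : g * e ^ 2 * a ^ 2 ≤ X ^ 2 + g * e ^ 2 * a ^ 2 + e * (Y ^ 2 + Z ^ 2) := by
    have : 0 ≤ X ^ 2 + e * (Y ^ 2 + Z ^ 2) := by positivity
    linarith
  have h2 : g * e ^ 2 * ((Y + u * a) ^ 2 + (Z + v * a) ^ 2) ≤
      (g * e + (u ^ 2 + v ^ 2)) * (X ^ 2 + g * e ^ 2 * a ^ 2 + e * (Y ^ 2 + Z ^ 2)) := by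
    have : 0 ≤ (g * e + (u ^ 2 + v ^ 2)) * X ^ 2
        + e * ((u * Y + v * Z - g * e * a) ^ 2 + (u * Z - v * Y) ^ 2) := by positivity
    linarith
  have h3 : g * e ^ 2 * (X + (e + (u ^ 2 + v ^ 2) / 2) * a + u * Y + v * Z) ^ 2 ≤
      (g * e ^ 2 + (e + (u ^ 2 + v ^ 2) / 2) ^ 2 + g * e * (u ^ 2 + v ^ 2)) *
        (X ^ 2 + g * e ^ 2 * a ^ 2 + e * (Y ^ 2 + Z ^ 2)) := by
    generalize hs : e + (u ^ 2 + v ^ 2) / 2 = s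
    have : 0 ≤ (s * X - g * e ^ 2 * a) ^ 2
        + g * e * ((e * Y - u * X) ^ 2 + (e * Z - v * X) ^ 2)
        + g * e ^ 2 * (u * Z - v * Y) ^ 2
        + e * ((s * Y - g * e * u * a) ^ 2 + (s * Z - g * e * v * a) ^ 2) := by positivity
    linarith
  linarith

/-- Coercivity of the quadratic form of `eulerH`, for any `t` below the three competing rates. -/
theorem mul_dotProduct_self_le_eulerH {γ ρ e t : ℝ} (u v : ℝ) (hγ1 : 1 < γ) (hγ2 : γ ≤ 2)
    (hρ : 0 < ρ) (he : 0 < e) (ht : 0 ≤ t) (h1 : t * (u ^ 2 + v ^ 2 + 2) ^ 2 ≤ e)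
    (h2 : t * (4 * (γ * e + 1)) ≤ 1) (h3 : t * (4 * γ * (u ^ 2 + v ^ 2 + 1)) ≤ 1)
    (x : Fin 4 → ℝ) :
    (γ - 1) ^ 2 * e * t * (x ⬝ᵥ x) ≤
      x ⬝ᵥ (eulerH γ ρ (ρ * u) (ρ * v) (e * (ρ * (γ - 1)))).mulVec x := by
  have hg : 0 < γ - 1 := sub_pos.mpr hγ1
  rw [dotProduct_eulerH_mulVec u v hg.ne' hρ.ne']
  have key := sq_norm_le_mul_diagonal_form hg he u v (x 0)
    (x 3 + (u ^ 2 + v ^ 2) / 2 * x 0 - u * x 1 - v * x 2 - e * x 0)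
    (x 1 - u * x 0) (x 2 - v * x 0)
  have hxx : x 0 ^ 2 + (x 1 - u * x 0 + u * x 0) ^ 2 + (x 2 - v * x 0 + v * x 0) ^ 2
      + (x 3 + (u ^ 2 + v ^ 2) / 2 * x 0 - u * x 1 - v * x 2 - e * x 0
        + (e + (u ^ 2 + v ^ 2) / 2) * x 0 + u * (x 1 - u * x 0) + v * (x 2 - v * x 0)) ^ 2
      = x ⬝ᵥ x := by
    simp only [dotProduct, Fin.sum_univ_four]
    ring
  rw [hxx, add_sub_cancel] at key
  set Q := (x 3 + (u ^ 2 + v ^ 2) / 2 * x 0 - u * x 1 - v * x 2 - e * x 0) ^ 2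
    + (γ - 1) * e ^ 2 * x 0 ^ 2 + e * ((x 1 - u * x 0) ^ 2 + (x 2 - v * x 0) ^ 2)
  have hQ : 0 ≤ Q := by positivity
  set q := u ^ 2 + v ^ 2
  have hq : 0 ≤ q := by positivity
  have hrate : t * ((q + 2) ^ 2 / 4 + γ * e ^ 2 + e * q + (γ - 1) * e * (1 + q)) ≤ e := by
    have h2e := mul_le_mul_of_nonneg_right h2 he.le
    have h3e := mul_le_mul_of_nonneg_right h3 he.le
    have : 0 ≤ t * e * (2 + γ * (q + 1)) := by positivity
    linarith
  refine le_of_mul_le_mul_left ?_ he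
  calc e * ((γ - 1) ^ 2 * e * t * (x ⬝ᵥ x))
      = (γ - 1) * t * ((γ - 1) * e ^ 2 * (x ⬝ᵥ x)) := by ring
    _ ≤ (γ - 1) * t *
        (((q + 2) ^ 2 / 4 + γ * e ^ 2 + e * q + (γ - 1) * e * (1 + q)) * Q) := by gcongr
    _ = (γ - 1) *
        (t * ((q + 2) ^ 2 / 4 + γ * e ^ 2 + e * q + (γ - 1) * e * (1 + q))) * Q := by ring
    _ ≤ 1 * e * Q := by
        gcongr
        linarith
    _ = e * Q := by ring

/-- Explicit lower bound on the smallest eigenvalue of the Euler entropy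
Hessian `A = (ρ(γ-1)/p²) • H` for `γ ∈ (1,2]`: every eigenvalue of `A` is at
least the explicit constant `c`, equivalently `A - c • I` is positive
semidefinite. -/
theorem eulerH_hessian_eigenvalue_lower_bound
    (γ ρ m1 m2 p : ℝ) (hγ1 : 1 < γ) (hγ2 : γ ≤ 2) (hρ : 0 < ρ) (hp : 0 < p) :
    (∀ μ : ℝ,
        Module.End.HasEigenvalue
          (Matrix.toLin' ((ρ * (γ - 1) / p ^ 2) • eulerH γ ρ m1 m2 p)) μ →
        (γ - 1) ^ 2 / p *
          min (min (p / (ρ * (γ - 1) * ((m1 ^ 2 + m2 ^ 2) / ρ ^ 2 + 2) ^ 2))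
                (ρ * (γ - 1) / (4 * (p * γ + ρ * (γ - 1)))))
            (1 / (4 * γ * ((m1 ^ 2 + m2 ^ 2) / ρ ^ 2 + 1))) ≤ μ) ∧
    ((ρ * (γ - 1) / p ^ 2) • eulerH γ ρ m1 m2 p
        - ((γ - 1) ^ 2 / p *
            min (min (p / (ρ * (γ - 1) * ((m1 ^ 2 + m2 ^ 2) / ρ ^ 2 + 2) ^ 2))
                  (ρ * (γ - 1) / (4 * (p * γ + ρ * (γ - 1)))))
              (1 / (4 * γ * ((m1 ^ 2 + m2 ^ 2) / ρ ^ 2 + 1)))) •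
          (1 : Matrix (Fin 4) (Fin 4) ℝ)).PosSemidef := by
  suffices h : ((ρ * (γ - 1) / p ^ 2) • eulerH γ ρ m1 m2 p
        - ((γ - 1) ^ 2 / p *
            min (min (p / (ρ * (γ - 1) * ((m1 ^ 2 + m2 ^ 2) / ρ ^ 2 + 2) ^ 2))
                  (ρ * (γ - 1) / (4 * (p * γ + ρ * (γ - 1)))))
              (1 / (4 * γ * ((m1 ^ 2 + m2 ^ 2) / ρ ^ 2 + 1)))) •
          (1 : Matrix (Fin 4) (Fin 4) ℝ)).PosSemidef from
    ⟨fun μ hμ => le_of_hasEigenvalue_of_posSemidef_sub_smul_one h hμ, h⟩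
  have hg : 0 < γ - 1 := sub_pos.mpr hγ1
  have hγ : 0 < γ := by linarith
  obtain ⟨u, rfl⟩ : ∃ u, m1 = ρ * u := ⟨m1 / ρ, by field_simp⟩
  obtain ⟨v, rfl⟩ : ∃ v, m2 = ρ * v := ⟨m2 / ρ, by field_simp⟩
  obtain ⟨e, rfl⟩ : ∃ e, p = e * (ρ * (γ - 1)) := ⟨p / (ρ * (γ - 1)), by field_simp⟩
  have he : 0 < e := pos_of_mul_pos_left hp (by positivity)
  have hq : ((ρ * u) ^ 2 + (ρ * v) ^ 2) / ρ ^ 2 = u ^ 2 + v ^ 2 := by field_simp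
  rw [hq]
  set t := min (min (e * (ρ * (γ - 1)) / (ρ * (γ - 1) * (u ^ 2 + v ^ 2 + 2) ^ 2))
      (ρ * (γ - 1) / (4 * (e * (ρ * (γ - 1)) * γ + ρ * (γ - 1)))))
    (1 / (4 * γ * (u ^ 2 + v ^ 2 + 1)))
  have ht : 0 ≤ t := by positivity
  have h1 : t * (u ^ 2 + v ^ 2 + 2) ^ 2 ≤ e := by
    have h : t ≤ e * (ρ * (γ - 1)) / (ρ * (γ - 1) * (u ^ 2 + v ^ 2 + 2) ^ 2) :=
      (min_le_left _ _).trans (min_le_left _ _)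
    rw [mul_comm e, mul_div_mul_left _ _ (by positivity)] at h
    exact (le_div_iff₀ (by positivity)).mp h
  have h2 : t * (4 * (γ * e + 1)) ≤ 1 := by
    have h : t ≤ ρ * (γ - 1) / (4 * (e * (ρ * (γ - 1)) * γ + ρ * (γ - 1))) :=
      (min_le_left _ _).trans (min_le_right _ _)
    rw [le_div_iff₀ (by positivity)] at h
    refine le_of_mul_le_mul_left ?_ (mul_pos hρ hg)
    linarith
  have h3 : t * (4 * γ * (u ^ 2 + v ^ 2 + 1)) ≤ 1 :=
    (le_div_iff₀ (by positivity)).mp (min_le_right _ _)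
  clear_value t
  refine Matrix.PosSemidef.of_dotProduct_mulVec_nonneg ?_ fun x => ?_
  · exact ((eulerH_isHermitian ..).smul (IsSelfAdjoint.all _)).sub
      (Matrix.isHermitian_one.smul (IsSelfAdjoint.all _))
  · have hx := mul_dotProduct_self_le_eulerH u v hγ1 hγ2 hρ he ht h1 h2 h3 x
    rw [Matrix.sub_mulVec, Matrix.smul_mulVec, Matrix.smul_mulVec, Matrix.one_mulVec,
      dotProduct_sub, dotProduct_smul, dotProduct_smul, smul_eq_mul, smul_eq_mul,
      star_trivial, sub_nonneg]
    calc (γ - 1) ^ 2 / (e * (ρ * (γ - 1))) * t * (x ⬝ᵥ x)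
        = ρ * (γ - 1) / (e * (ρ * (γ - 1))) ^ 2 * ((γ - 1) ^ 2 * e * t * (x ⬝ᵥ x)) := by
          field_simp
      _ ≤ _ := by gcongr
end
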